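/- Suppose the pair predictor p̂₂ is pair-calibrated with grouping function Φ, and let (Ω, P), X, Ỹ, A be as in the conditional-independence setup (A is the event that a decoding algorithm responds, Ỹ its response). Then the statistical hallucination rate of the generated responses is bounded as P[ p(Ỹ|X) = 0 | A ] ≤ 1 − E[ C(Ỹ|X) | A ]. -/

import Mathlib

open Finset

open scoped Classical

/-- Conditional expectation of `f(X)` given `X ∈ [x]_Φ`, where `X ∼ μ` on a finite set. -/
noncomputable def groupExp {𝒳 𝒵 : Type*} [Fintype 𝒳] (μ : 𝒳 → ℝ) (Φ : 𝒳 → 𝒵)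
    (f : 𝒳 → ℝ) (x : 𝒳) : ℝ :=
  (∑ x' : 𝒳, if Φ x' = Φ x then μ x' * f x' else 0) /
  (∑ x' : 𝒳, if Φ x' = Φ x then μ x' else 0)

/-- Marginal `p̂₁(y|x) = ∑_{y'} p̂₂(y,y'|x)` of a pair predictor. -/
noncomputable def marginal {𝒳 𝒴 : Type*} [Fintype 𝒴] (p2 : 𝒳 → 𝒴 → 𝒴 → ℝ) (x : 𝒳) (y : 𝒴) : ℝ :=
  ∑ y' : 𝒴, p2 x y y'

/-- Cheat-corrected epistemic variance `V̂(y|x) = p̂₂(y,y|x) − p̂₁(y|x)²`. -/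
noncomputable def cheatVar {𝒳 𝒴 : Type*} [Fintype 𝒴] (p2 : 𝒳 → 𝒴 → 𝒴 → ℝ) (x : 𝒳) (y : 𝒴) : ℝ :=
  p2 x y y - (marginal p2 x y) ^ 2

/-- Cheat-corrected epistemic confidence `C(y|x)`. -/
noncomputable def cheatConf {𝒳 𝒴 : Type*} [Fintype 𝒴] (p2 : 𝒳 → 𝒴 → 𝒴 → ℝ) (x : 𝒳) (y : 𝒴) : ℝ :=
  if 0 < p2 x y y then (marginal p2 x y) ^ 2 / p2 x y y else 0


open MeasureTheory in
/-- The integral over `A` of a function of a finite-valued random variable is a finite sum. -/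
lemma setIntegral_comp_eq_sum {Ω α : Type*} [MeasurableSpace Ω] [Fintype α]
    (P : Measure Ω) [IsFiniteMeasure P] (Z : Ω → α) (hZ : ∀ a, MeasurableSet (Z ⁻¹' {a}))
    (A : Set Ω) (g : α → ℝ) :
    ∫ ω in A, g (Z ω) ∂P = ∑ a, P.real (Z ⁻¹' {a} ∩ A) * g a := by
  let _ : MeasurableSpace α := ⊤
  have hZm : Measurable Z := measurable_to_countable' hZ
  have hg : Measurable g := measurable_from_top
  rw [← integral_map (μ := P.restrict A) hZm.aemeasurable hg.aestronglyMeasurable,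
    integral_fintype .of_finite]
  refine Finset.sum_congr rfl fun a _ => ?_
  rw [map_measureReal_apply hZm trivial, measureReal_restrict_apply (hZ a), smul_eq_mul]

lemma groupExp_congr {𝒳 𝒵 : Type*} [Fintype 𝒳] (μ : 𝒳 → ℝ) (Φ : 𝒳 → 𝒵)
    (f : 𝒳 → ℝ) {x x₀ : 𝒳} (h : Φ x = Φ x₀) : groupExp μ Φ f x = groupExp μ Φ f x₀ := by
  simp only [groupExp, h]

lemma marginal_eq_groupExp {𝒳 𝒴 𝒵 : Type*} [Fintype 𝒳] [Fintype 𝒴] {μ : 𝒳 → ℝ}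
    {p : 𝒳 → 𝒴 → ℝ} (hp1 : ∀ x, ∑ y, p x y = 1) {p2 : 𝒳 → 𝒴 → 𝒴 → ℝ} {Φ : 𝒳 → 𝒵}
    (hcal : ∀ x y₁ y₂, p2 x y₁ y₂ = groupExp μ Φ (fun x' => p x' y₁ * p x' y₂) x)
    (x : 𝒳) (y : 𝒴) : marginal p2 x y = groupExp μ Φ (fun x' => p x' y) x := by
  simp only [marginal, hcal, groupExp]
  rw [← Finset.sum_div, Finset.sum_comm]
  congr 1
  refine Finset.sum_congr rfl fun x' _ => ?_
  split_ifs
  · rw [← Finset.mul_sum, ← Finset.mul_sum, hp1, mul_one]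
  · simp

/-- Within a class of the grouping function, the mass of the inputs for which `y` is possible is
at least the confidence times the mass of the class. -/
lemma sum_mul_cheatConf_le {𝒳 𝒴 𝒵 : Type*} [Fintype 𝒳] [Fintype 𝒴] {μ : 𝒳 → ℝ}
    (hμpos : ∀ x, 0 < μ x) {p : 𝒳 → 𝒴 → ℝ} (hp1 : ∀ x, ∑ y, p x y = 1)
    {p2 : 𝒳 → 𝒴 → 𝒴 → ℝ} {Φ : 𝒳 → 𝒵}
    (hcal : ∀ x y₁ y₂, p2 x y₁ y₂ = groupExp μ Φ (fun x' => p x' y₁ * p x' y₂) x)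
    (x₀ : 𝒳) (y : 𝒴) :
    (∑ x with Φ x = Φ x₀, μ x) * cheatConf p2 x₀ y
      ≤ ∑ x with Φ x = Φ x₀, μ x * (if p x y = 0 then 0 else 1) := by
  have hR : 0 ≤ ∑ x with Φ x = Φ x₀, μ x * (if p x y = 0 then (0 : ℝ) else 1) :=
    Finset.sum_nonneg fun x _ => mul_nonneg (hμpos x).le (by split_ifs <;> norm_num)
  have hM : 0 < ∑ x with Φ x = Φ x₀, μ x :=
    Finset.sum_pos (fun x _ => hμpos x) ⟨x₀, by simp⟩
  have hCS : (∑ x with Φ x = Φ x₀, μ x * p x y) ^ 2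
      ≤ (∑ x with Φ x = Φ x₀, μ x * (if p x y = 0 then (0 : ℝ) else 1)) *
        ∑ x with Φ x = Φ x₀, μ x * (p x y * p x y) := by
    refine Finset.sum_sq_le_sum_mul_sum_of_sq_le_mul _
      (fun x _ => mul_nonneg (hμpos x).le (by split_ifs <;> norm_num))
      (fun x _ => mul_nonneg (hμpos x).le (mul_self_nonneg _)) fun x _ => ?_
    split_ifs with h
    · simp [h]
    · exact le_of_eq (by ring)
  unfold cheatConf
  split_ifs with hpos
  · rw [marginal_eq_groupExp hp1 hcal]
    rw [hcal] at hpos ⊢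
    simp only [groupExp, ← Finset.sum_filter] at hpos ⊢
    have hS := (div_pos_iff_of_pos_right hM).1 hpos
    calc _ = (∑ x with Φ x = Φ x₀, μ x * p x y) ^ 2 /
          ∑ x with Φ x = Φ x₀, μ x * (p x y * p x y) := by field_simp
      _ ≤ _ := (div_le_iff₀ hS).2 hCS
  · simpa using hR

lemma cheatConf_congr {𝒳 𝒴 𝒵 : Type*} [Fintype 𝒳] [Fintype 𝒴] {μ : 𝒳 → ℝ}
    {p : 𝒳 → 𝒴 → ℝ} {p2 : 𝒳 → 𝒴 → 𝒴 → ℝ} {Φ : 𝒳 → 𝒵}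
    (hcal : ∀ x y₁ y₂, p2 x y₁ y₂ = groupExp μ Φ (fun x' => p x' y₁ * p x' y₂) x)
    {x x₀ : 𝒳} (h : Φ x = Φ x₀) (y : 𝒴) : cheatConf p2 x y = cheatConf p2 x₀ y := by
  have hp2 : ∀ y₁ y₂, p2 x y₁ y₂ = p2 x₀ y₁ y₂ := fun y₁ y₂ => by
    rw [hcal, hcal, groupExp_congr μ Φ _ h]
  simp only [cheatConf, marginal, hp2]

/-- Averaged form of `sum_mul_cheatConf_le`, for weights constant on the classes. -/
lemma sum_weight_mul_cheatConf_le {𝒳 𝒴 𝒵 : Type*} [Fintype 𝒳] [Fintype 𝒴] {μ : 𝒳 → ℝ}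
    (hμpos : ∀ x, 0 < μ x) {p : 𝒳 → 𝒴 → ℝ} (hp1 : ∀ x, ∑ y, p x y = 1)
    {p2 : 𝒳 → 𝒴 → 𝒴 → ℝ} {Φ : 𝒳 → 𝒵}
    (hcal : ∀ x y₁ y₂, p2 x y₁ y₂ = groupExp μ Φ (fun x' => p x' y₁ * p x' y₂) x)
    {r : 𝒳 → ℝ} (hr0 : ∀ x, 0 ≤ r x) (hr : ∀ x x₀, Φ x = Φ x₀ → r x = r x₀) (y : 𝒴) :
    ∑ x, μ x * r x * cheatConf p2 x y
      ≤ ∑ x, μ x * r x * (if p x y = 0 then 0 else 1) := by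
  have hmaps : ∀ x ∈ (univ : Finset 𝒳), Φ x ∈ univ.image Φ := fun x hx =>
    Finset.mem_image_of_mem Φ hx
  rw [← Finset.sum_fiberwise_of_maps_to hmaps, ← Finset.sum_fiberwise_of_maps_to hmaps]
  refine Finset.sum_le_sum fun z hz => ?_
  obtain ⟨x₀, -, rfl⟩ := Finset.mem_image.1 hz
  calc _ = r x₀ * ((∑ x with Φ x = Φ x₀, μ x) * cheatConf p2 x₀ y) := by
        rw [Finset.sum_mul, Finset.mul_sum]
        refine Finset.sum_congr rfl fun x hx => ?_
        have h := (Finset.mem_filter.1 hx).2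
        rw [hr x x₀ h, cheatConf_congr hcal h]
        ring
    _ ≤ r x₀ * ∑ x with Φ x = Φ x₀, μ x * (if p x y = 0 then 0 else 1) :=
        mul_le_mul_of_nonneg_left (sum_mul_cheatConf_le hμpos hp1 hcal x₀ y) (hr0 x₀)
    _ = _ := by
        rw [Finset.mul_sum]
        refine Finset.sum_congr rfl fun x hx => ?_
        rw [hr x x₀ (Finset.mem_filter.1 hx).2]
        ring

/-- The statistical hallucination rate of a decoding algorithm whose
response `Ỹ` and response event `A` are conditionally independent of `X` given `Φ(X)`
is bounded by one minus the conditional expectation of the cheat-corrected epistemic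
confidence. -/
theorem stmt_12 {𝒳 𝒴 𝒵 : Type*} [Fintype 𝒳] [Fintype 𝒴] [Nonempty 𝒳] [Nonempty 𝒴]
    (μ : 𝒳 → ℝ) (hμpos : ∀ x, 0 < μ x) (hμsum : ∑ x, μ x = 1)
    (p : 𝒳 → 𝒴 → ℝ) (hp0 : ∀ x y, 0 ≤ p x y) (hp1 : ∀ x, ∑ y, p x y = 1)
    (p2 : 𝒳 → 𝒴 → 𝒴 → ℝ)
    (hp20 : ∀ x y₁ y₂, 0 ≤ p2 x y₁ y₂) (hp21 : ∀ x, ∑ y₁, ∑ y₂, p2 x y₁ y₂ = 1)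
    (Φ : 𝒳 → 𝒵)
    (hcal : ∀ x y₁ y₂, p2 x y₁ y₂ = groupExp μ Φ (fun x' => p x' y₁ * p x' y₂) x)
    {Ω : Type*} [MeasurableSpace Ω] (P : MeasureTheory.Measure Ω)
    [MeasureTheory.IsProbabilityMeasure P]
    (X : Ω → 𝒳) (Yt : Ω → 𝒴) (A : Set Ω)
    (hA : MeasurableSet A) (hXm : ∀ x, MeasurableSet {ω | X ω = x})
    (hYm : ∀ y, MeasurableSet {ω | Yt ω = y})
    (hPA : 0 < P A)
    (hdist : ∀ x, P {ω | X ω = x} = ENNReal.ofReal (μ x))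
    (hCI : ∀ (x : 𝒳) (y : 𝒴),
      P ({ω | Yt ω = y} ∩ A ∩ {ω | X ω = x}) * P {ω | Φ (X ω) = Φ x}
        = P ({ω | Yt ω = y} ∩ A ∩ {ω | Φ (X ω) = Φ x}) * P {ω | X ω = x}) :
    (P (A ∩ {ω | p (X ω) (Yt ω) = 0})).toReal / (P A).toReal
      ≤ 1 - (∫ ω in A, cheatConf p2 (X ω) (Yt ω) ∂P) / (P A).toReal := by
  let Z : Ω → 𝒳 × 𝒴 := fun ω => (X ω, Yt ω)
  have hZpre : ∀ a, Z ⁻¹' {a} = {ω | X ω = a.1} ∩ {ω | Yt ω = a.2} := fun a => by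
    ext ω
    simp [Z, Prod.ext_iff]
  have hZ : ∀ a, MeasurableSet (Z ⁻¹' {a}) := fun a => by
    rw [hZpre]
    exact (hXm a.1).inter (hYm a.2)
  have hsum := setIntegral_comp_eq_sum P Z hZ A
  have hPA' : 0 < (P A).toReal := ENNReal.toReal_pos hPA.ne' (MeasureTheory.measure_ne_top P A)
  let r : 𝒴 → 𝒳 → ℝ := fun y x =>
    P.real ({ω | Yt ω = y} ∩ A ∩ {ω | Φ (X ω) = Φ x}) / P.real {ω | Φ (X ω) = Φ x}
  have hq : ∀ x y, P.real (Z ⁻¹' {(x, y)} ∩ A) = μ x * r y x := fun x y => by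
    have hset : Z ⁻¹' {(x, y)} ∩ A = {ω | Yt ω = y} ∩ A ∩ {ω | X ω = x} := by
      rw [hZpre]
      ext ω
      simp only [Set.mem_inter_iff, Set.mem_ofPred_eq]
      tauto
    have hX : P.real {ω | X ω = x} = μ x := by
      rw [MeasureTheory.measureReal_def, hdist, ENNReal.toReal_ofReal (hμpos x).le]
    have hM : 0 < P.real {ω | Φ (X ω) = Φ x} := by
      refine (hX ▸ hμpos x).trans_le (MeasureTheory.measureReal_mono fun ω hω => ?_)
      exact congrArg Φ hω
    have h := congrArg ENNReal.toReal (hCI x y)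
    rw [ENNReal.toReal_mul, ENNReal.toReal_mul] at h
    simp only [← MeasureTheory.measureReal_def, hX] at h
    rw [hset, ← mul_div_assoc, eq_div_iff hM.ne', h, mul_comm]
  have hC : ∫ ω in A, cheatConf p2 (X ω) (Yt ω) ∂P
      = ∑ y, ∑ x, μ x * r y x * cheatConf p2 x y := by
    rw [hsum fun a => cheatConf p2 a.1 a.2, Fintype.sum_prod_type_right]
    simp only [hq]
  have hH : (P A).toReal - (P (A ∩ {ω | p (X ω) (Yt ω) = 0})).toReal
      = ∑ y, ∑ x, μ x * r y x * (if p x y = 0 then 0 else 1) := by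
    have hmeas : MeasurableSet {ω | p (X ω) (Yt ω) = 0} := by
      have : {ω | p (X ω) (Yt ω) = 0} = ⋃ a ∈ {a : 𝒳 × 𝒴 | p a.1 a.2 = 0}, Z ⁻¹' {a} := by
        ext ω
        simp [Z]
      rw [this]
      exact MeasurableSet.biUnion (Set.to_countable _) fun a _ => hZ a
    have hdiff : (P A).toReal - (P (A ∩ {ω | p (X ω) (Yt ω) = 0})).toReal
        = P.real (A \ {ω | p (X ω) (Yt ω) = 0}) := by
      rw [sub_eq_iff_eq_add']
      exact (MeasureTheory.measureReal_inter_add_sdiff hmeas).symm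
    have hint : ∫ ω in A, (if p (X ω) (Yt ω) = 0 then (0 : ℝ) else 1) ∂P
        = P.real (A \ {ω | p (X ω) (Yt ω) = 0}) := by
      have hind : (fun ω => if p (X ω) (Yt ω) = 0 then (0 : ℝ) else 1)
          = {ω | p (X ω) (Yt ω) = 0}ᶜ.indicator 1 := by
        ext ω
        by_cases h : p (X ω) (Yt ω) = 0 <;> simp [h]
      rw [hind, MeasureTheory.integral_indicator_one hmeas.compl,
        MeasureTheory.measureReal_restrict_apply hmeas.compl, Set.inter_comm, Set.sdiff_eq]
    rw [hdiff, ← hint, hsum fun a => if p a.1 a.2 = 0 then (0 : ℝ) else 1,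
      Fintype.sum_prod_type_right]
    simp only [hq]
  have hle : ∫ ω in A, cheatConf p2 (X ω) (Yt ω) ∂P
      ≤ (P A).toReal - (P (A ∩ {ω | p (X ω) (Yt ω) = 0})).toReal := by
    rw [hC, hH]
    refine Finset.sum_le_sum fun y _ => sum_weight_mul_cheatConf_le hμpos hp1 hcal
      (fun x => div_nonneg MeasureTheory.measureReal_nonneg MeasureTheory.measureReal_nonneg)
      (fun x x₀ h => ?_) y
    simp only [h]
  rw [le_sub_iff_add_le, ← add_div, div_le_one hPA']
  linarith
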